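/- arXiv:2603.03628 — 10 statements merged into one kernel-verified Lean document; each statement's English description precedes it below -/
import Mathlib

section
/- In F = ℚ(A,q) the SO(N+1) quantum dimensions attached to Young diagrams with three boxes satisfy the plethysm (sum rule) identity d₍₁₎³ = d₍₃₎ + 2·d₍₂₁₎ + d₍₁₁₁₎ + 3·d₍₁₎. -/
/- STATEMENT 1: In F = ℚ(A,q) the SO(N+1) quantum dimensions attached to Young diagrams
with three boxes satisfy the plethysm identity d₍₁₎³ = d₍₃₎ + 2·d₍₂₁₎ + d₍₁₁₁₎ + 3·d₍₁₎. -/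

noncomputable section

open MvPolynomial

/-- The field `ℚ(A, q)` of rational functions in two variables over `ℚ`. -/
abbrev F : Type := FractionRing (MvPolynomial (Fin 2) ℚ)

/-- The variable `A` in `ℚ(A, q)`. -/
def A : F := algebraMap (MvPolynomial (Fin 2) ℚ) F (X 0)

/-- The variable `q` in `ℚ(A, q)`. -/
def q : F := algebraMap (MvPolynomial (Fin 2) ℚ) F (X 1)

/-- The quantum bracket `{x} = x - x⁻¹`. -/
def br (x : F) : F := x - x⁻¹

def d₁ : F := 1 + br A / br q

def S₃ : F := br A * br (A * q) * br (A * q ^ 2) / (br q * br (q ^ 2) * br (q ^ 3))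

def S₂₁ : F := br A * br (A * q) * br (A * q⁻¹) / (br q ^ 2 * br (q ^ 3))

def S₁₁₁ : F := br A * br (A * q⁻¹) * br (A * (q ^ 2)⁻¹) / (br q * br (q ^ 2) * br (q ^ 3))

def d₃ : F := (1 + br (q ^ 3) / br (A * q ^ 2)) * S₃

def d₂₁ : F := (1 + br (q ^ 3) / br A) * S₂₁

def d₁₁₁ : F := (1 + br (q ^ 3) / br (A * (q ^ 2)⁻¹)) * S₁₁₁

lemma algebraMap_ne_of_eval_ne {p r : MvPolynomial (Fin 2) ℚ} (v : Fin 2 → ℚ)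
    (h : eval v p ≠ eval v r) :
    algebraMap (MvPolynomial (Fin 2) ℚ) F p ≠ algebraMap (MvPolynomial (Fin 2) ℚ) F r :=
  fun hpr => h (congrArg (eval v) (IsFractionRing.injective _ F hpr))

lemma A_ne_zero : A ≠ 0 := by
  simp [A]

lemma q_ne_zero : q ≠ 0 := by
  simp [q]

lemma br_ne_zero {x : F} (hx : x ≠ 0) (h : x ^ 2 ≠ 1) : br x ≠ 0 := by
  intro hb
  apply h
  rw [br, sub_eq_zero] at hb
  rw [sq]
  nth_rewrite 2 [hb]
  exact mul_inv_cancel₀ hx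

lemma A_pow_mul_q_pow_ne (a b c : ℕ) (h : (3 : ℚ) ^ a * 2 ^ b ≠ 2 ^ c) :
    A ^ a * q ^ b ≠ q ^ c := by
  have hne := algebraMap_ne_of_eval_ne (p := X 0 ^ a * X 1 ^ b) (r := X 1 ^ c) ![3, 2]
    (by simpa using h)
  rwa [map_mul, map_pow, map_pow, map_pow] at hne

lemma br_q_pow_ne_zero {n : ℕ} (hn : n ≠ 0) : br (q ^ n) ≠ 0 := by
  refine br_ne_zero (pow_ne_zero n q_ne_zero) ?_
  rw [← pow_mul]
  have h := A_pow_mul_q_pow_ne 0 (n * 2) 0 (by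
    simpa using (one_lt_pow₀ (by norm_num : (1 : ℚ) < 2) (by positivity : n * 2 ≠ 0)).ne')
  simpa using h

lemma br_A_ne_zero : br A ≠ 0 :=
  br_ne_zero A_ne_zero (by simpa using A_pow_mul_q_pow_ne 2 0 0 (by norm_num))

lemma br_A_mul_q_sq_ne_zero : br (A * q ^ 2) ≠ 0 := by
  refine br_ne_zero (mul_ne_zero A_ne_zero (pow_ne_zero 2 q_ne_zero)) ?_
  simpa [mul_pow, ← pow_mul] using A_pow_mul_q_pow_ne 2 4 0 (by norm_num)

lemma br_A_mul_inv_q_sq_ne_zero : br (A * (q ^ 2)⁻¹) ≠ 0 := by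
  have hq := pow_ne_zero 2 q_ne_zero
  refine br_ne_zero (mul_ne_zero A_ne_zero (inv_ne_zero hq)) ?_
  rw [← div_eq_mul_inv, div_pow, Ne, div_eq_one_iff_eq (pow_ne_zero 2 hq), ← pow_mul]
  simpa using A_pow_mul_q_pow_ne 2 0 4 (by norm_num)

lemma d₃_eq : d₃ = (br (A * q ^ 2) + br (q ^ 3)) * (br A * br (A * q)) /
    (br q * br (q ^ 2) * br (q ^ 3)) := by
  rw [d₃, S₃, one_add_div br_A_mul_q_sq_ne_zero]
  field_simp [br_A_mul_q_sq_ne_zero]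

lemma d₂₁_eq : d₂₁ = (br A + br (q ^ 3)) * (br (A * q) * br (A * q⁻¹)) /
    (br q ^ 2 * br (q ^ 3)) := by
  rw [d₂₁, S₂₁, one_add_div br_A_ne_zero]
  field_simp [br_A_ne_zero]

lemma d₁₁₁_eq : d₁₁₁ = (br (A * (q ^ 2)⁻¹) + br (q ^ 3)) * (br A * br (A * q⁻¹)) /
    (br q * br (q ^ 2) * br (q ^ 3)) := by
  rw [d₁₁₁, S₁₁₁, one_add_div br_A_mul_inv_q_sq_ne_zero]
  have hx := br_A_mul_inv_q_sq_ne_zero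
  generalize br (A * (q ^ 2)⁻¹) = x at hx ⊢
  field_simp

theorem plethysm_three_boxes : d₁ ^ 3 = d₃ + 2 * d₂₁ + d₁₁₁ + 3 * d₁ := by
  have h1 : br q ≠ 0 := by simpa using br_q_pow_ne_zero one_ne_zero
  have h2 := br_q_pow_ne_zero two_ne_zero
  have h3 := br_q_pow_ne_zero three_ne_zero
  have key : (br q + br A) ^ 3 * (br (q ^ 2) * br (q ^ 3)) =
      br q ^ 2 * ((br (A * q ^ 2) + br (q ^ 3)) * (br A * br (A * q)))
      + 2 * (br q * br (q ^ 2) * ((br A + br (q ^ 3)) * (br (A * q) * br (A * q⁻¹))))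
      + br q ^ 2 * ((br (A * (q ^ 2)⁻¹) + br (q ^ 3)) * (br A * br (A * q⁻¹)))
      + 3 * (br q ^ 2 * br (q ^ 2) * br (q ^ 3) * (br q + br A)) := by
    have hA := A_ne_zero
    have hq := q_ne_zero
    simp only [br]
    field_simp
    ring
  rw [d₃_eq, d₂₁_eq, d₁₁₁_eq, d₁, one_add_div h1]
  generalize br (q ^ 2) = y at *
  generalize br (q ^ 3) = z at *
  generalize br q = x at *
  generalize br (A * q ^ 2) = a at *
  generalize br (A * (q ^ 2)⁻¹) = b at *
  generalize br (A * q⁻¹) = c at *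
  generalize br (A * q) = d at *
  generalize br A = e at *
  field_simp
  linear_combination key

end
end

section
/- For every h ∈ ℚ(A,q) and every even integer w, the difference between the SO(N+1) and SU(N) character expansions of a 3-strand knot with Racah coefficients (q^w, h, q^{−w}) admits the closed form: A^{−w}·( q^{w}·d₍₃₎/d₍₁₎ + h·d₍₂₁₎/d₍₁₎ + q^{−w}·d₍₁₁₁₎/d₍₁₎ ) − A^{−w}·( q^{w}·S₍₃₎/S₍₁₎ + h·S₍₂₁₎/S₍₁₎ + q^{−w}·S₍₁₁₁₎/S₍₁₎ ) = ( A^{−w}/(q² + 1 + q⁻²) )·( {A}/{q} − 1 )·( q^{w} + h·(q² + q⁻²) + q^{−w} ). -/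
/- STATEMENT 4: For every h ∈ ℚ(A,q) and every even integer w, the difference between
the SO(N+1) and SU(N) character expansions of a 3-strand knot with Racah coefficients
(q^w, h, q^{−w}) admits the stated closed form. -/

noncomputable section

open MvPolynomial

def S₁ : F := br A / br q

lemma algebraMap_ne_zero_of_eval (p : MvPolynomial (Fin 2) ℚ) (x : Fin 2 → ℚ)
    (hp : eval x p ≠ 0) : algebraMap (MvPolynomial (Fin 2) ℚ) F p ≠ 0 := by
  intro h
  have hp0 : p = 0 := (map_eq_zero_iff _ (IsFractionRing.injective _ F)).mp h
  exact hp (by rw [hp0, map_zero])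

lemma br_eq_div {x : F} (hx : x ≠ 0) : br x = (x ^ 2 - 1) / x := by
  unfold br
  field_simp

lemma A_sq_sub_one_ne_zero : A ^ 2 - 1 ≠ 0 := by
  have h := algebraMap_ne_zero_of_eval (X 0 ^ 2 - 1) ![3, 2] (by norm_num)
  simp only [map_sub, map_pow, map_one] at h
  exact h

lemma q_sq_sub_one_ne_zero : q ^ 2 - 1 ≠ 0 := by
  have h := algebraMap_ne_zero_of_eval (X 1 ^ 2 - 1) ![3, 2] (by norm_num)
  simp only [map_sub, map_pow, map_one] at h
  exact h

lemma q_sq_add_one_ne_zero : q ^ 2 + 1 ≠ 0 := by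
  have h := algebraMap_ne_zero_of_eval (X 1 ^ 2 + 1) ![3, 2] (by norm_num)
  simp only [map_add, map_pow, map_one] at h
  exact h

lemma q_cyclotomic_ne_zero : q ^ 2 * (q ^ 2 + 1) + 1 ≠ 0 := by
  have h := algebraMap_ne_zero_of_eval (X 1 ^ 2 * (X 1 ^ 2 + 1) + 1) ![3, 2] (by norm_num)
  simp only [map_mul, map_add, map_pow, map_one] at h
  exact h

lemma q_pow_mul_A_sq_sub_one_ne_zero : q ^ 4 * A ^ 2 - 1 ≠ 0 := by
  have h := algebraMap_ne_zero_of_eval (X 1 ^ 4 * X 0 ^ 2 - 1) ![3, 2] (by norm_num)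
  simp only [map_sub, map_mul, map_pow, map_one] at h
  exact h

lemma A_sq_sub_q_ne_zero : A ^ 2 - q ^ 4 ≠ 0 := by
  have h := algebraMap_ne_zero_of_eval (X 0 ^ 2 - X 1 ^ 4) ![3, 2] (by norm_num)
  simp only [map_sub, map_pow] at h
  exact h

lemma A_add_q_ne_zero : A + q ≠ 0 := by
  have h := algebraMap_ne_zero_of_eval (X 0 + X 1) ![3, 2] (by norm_num)
  simp only [map_add] at h
  exact h

lemma q_mul_A_sub_one_ne_zero : q * A - 1 ≠ 0 := by
  have h := algebraMap_ne_zero_of_eval (X 1 * X 0 - 1) ![3, 2] (by norm_num)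
  simp only [map_sub, map_mul, map_one] at h
  exact h

lemma br_A : br A = (A ^ 2 - 1) / A := br_eq_div A_ne_zero

lemma br_q : br q = (q ^ 2 - 1) / q := br_eq_div q_ne_zero

lemma br_q_sq : br (q ^ 2) = (q ^ 2 - 1) * (q ^ 2 + 1) / q ^ 2 := by
  rw [br_eq_div (pow_ne_zero _ q_ne_zero)]
  ring

lemma br_q_cube : br (q ^ 3) = (q ^ 2 - 1) * (q ^ 4 + q ^ 2 + 1) / q ^ 3 := by
  rw [br_eq_div (pow_ne_zero _ q_ne_zero)]
  ring

lemma br_A_mul_q : br (A * q) = (A * q - 1) * (A * q + 1) / (A * q) := by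
  rw [br_eq_div (mul_ne_zero A_ne_zero q_ne_zero)]
  ring

lemma br_A_mul_q_sq : br (A * q ^ 2) = (A ^ 2 * q ^ 4 - 1) / (A * q ^ 2) := by
  rw [br_eq_div (mul_ne_zero A_ne_zero (pow_ne_zero _ q_ne_zero))]
  ring

lemma br_A_mul_q_inv : br (A * q⁻¹) = (A + q) * (A - q) / (A * q) := by
  have hA := A_ne_zero
  have hq := q_ne_zero
  unfold br
  field_simp
  ring

lemma br_A_mul_q_sq_inv : br (A * (q ^ 2)⁻¹) = (A ^ 2 - q ^ 4) / (A * q ^ 2) := by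
  have hA := A_ne_zero
  have hq := q_ne_zero
  unfold br
  field_simp

lemma S₁_eq : S₁ = (A ^ 2 - 1) * q / (A * (q ^ 2 - 1)) := by
  have hA := A_ne_zero
  have hq := q_ne_zero
  have hq1 := q_sq_sub_one_ne_zero
  rw [S₁, br_A, br_q]
  field_simp

lemma d₁_eq : d₁ = (A + q) * (A * q - 1) / (A * (q ^ 2 - 1)) := by
  have hA := A_ne_zero
  have hq := q_ne_zero
  have hq1 := q_sq_sub_one_ne_zero
  rw [d₁, br_A, br_q]
  field_simp
  ring

lemma d₃_div_sub_S₃_div :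
    d₃ / d₁ - S₃ / S₁ =
      (br A / br q - 1) / (q ^ 2 + 1 + (q ^ 2)⁻¹) := by
  have hA := A_ne_zero
  have hq := q_ne_zero
  have hA1 := A_sq_sub_one_ne_zero
  have hq1 := q_sq_sub_one_ne_zero
  have hq2 := q_sq_add_one_ne_zero
  have hq3 := q_cyclotomic_ne_zero
  have hAq := A_add_q_ne_zero
  have hAq1 := q_mul_A_sub_one_ne_zero
  have hAq4 := q_pow_mul_A_sq_sub_one_ne_zero
  have hc : q ^ 2 + 1 + (q ^ 2)⁻¹ = (q ^ 4 + q ^ 2 + 1) / q ^ 2 := by field_simp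
  rw [hc, S₁_eq, d₁_eq, d₃, S₃]
  simp only [br_A, br_q, br_q_sq, br_q_cube, br_A_mul_q, br_A_mul_q_sq]
  field_simp
  ring

lemma d₂₁_div_sub_S₂₁_div :
    d₂₁ / d₁ - S₂₁ / S₁ =
      (br A / br q - 1) * (q ^ 2 + (q ^ 2)⁻¹) / (q ^ 2 + 1 + (q ^ 2)⁻¹) := by
  have hA := A_ne_zero
  have hq := q_ne_zero
  have hA1 := A_sq_sub_one_ne_zero
  have hq1 := q_sq_sub_one_ne_zero
  have hq3 := q_cyclotomic_ne_zero
  have hAq := A_add_q_ne_zero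
  have hAq1 := q_mul_A_sub_one_ne_zero
  have hc : q ^ 2 + 1 + (q ^ 2)⁻¹ = (q ^ 4 + q ^ 2 + 1) / q ^ 2 := by field_simp
  rw [hc, S₁_eq, d₁_eq, d₂₁, S₂₁]
  simp only [br_A, br_q, br_q_cube, br_A_mul_q, br_A_mul_q_inv]
  field_simp
  ring

lemma d₁₁₁_div_sub_S₁₁₁_div :
    d₁₁₁ / d₁ - S₁₁₁ / S₁ =
      (br A / br q - 1) / (q ^ 2 + 1 + (q ^ 2)⁻¹) := by
  have hA := A_ne_zero
  have hq := q_ne_zero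
  have hA1 := A_sq_sub_one_ne_zero
  have hq1 := q_sq_sub_one_ne_zero
  have hq2 := q_sq_add_one_ne_zero
  have hq3 := q_cyclotomic_ne_zero
  have hAq := A_add_q_ne_zero
  have hAq1 := q_mul_A_sub_one_ne_zero
  have hAq4 := A_sq_sub_q_ne_zero
  have hc : q ^ 2 + 1 + (q ^ 2)⁻¹ = (q ^ 4 + q ^ 2 + 1) / q ^ 2 := by field_simp
  rw [hc, S₁_eq, d₁_eq, d₁₁₁, S₁₁₁]
  simp only [br_A, br_q, br_q_sq, br_q_cube, br_A_mul_q_inv, br_A_mul_q_sq_inv]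
  field_simp
  ring

theorem so_su_character_difference (h : F) (w : ℤ) (hw : Even w) :
    A ^ (-w) * (q ^ w * (d₃ / d₁) + h * (d₂₁ / d₁) + q ^ (-w) * (d₁₁₁ / d₁)) -
      A ^ (-w) * (q ^ w * (S₃ / S₁) + h * (S₂₁ / S₁) + q ^ (-w) * (S₁₁₁ / S₁)) =
    (A ^ (-w) / (q ^ 2 + 1 + (q ^ 2)⁻¹)) * (br A / br q - 1) *
      (q ^ w + h * (q ^ 2 + (q ^ 2)⁻¹) + q ^ (-w)) := by
  linear_combination A ^ (-w) * q ^ w * d₃_div_sub_S₃_div +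
    A ^ (-w) * h * d₂₁_div_sub_S₂₁_div + A ^ (-w) * q ^ (-w) * d₁₁₁_div_sub_S₁₁₁_div

end
end

section
/- The matrices ρ₀(σ₁), ρ₀(σ₂), ρ₀(e₁), ρ₀(e₂) satisfy all the defining relations of the 3-strand Birman–Murakami–Wenzl algebra C₃(α,β): (i) the braid relation ρ₀(σ₁)·ρ₀(σ₂)·ρ₀(σ₁) = ρ₀(σ₂)·ρ₀(σ₁)·ρ₀(σ₂); (ii) the Kauffman skein relation ρ₀(σᵢ) + ρ₀(σᵢ)⁻¹ = z·(1 + ρ₀(eᵢ)) for i = 1, 2, where 1 is the 3×3 identity matrix; (iii) the idempotent relation ρ₀(eᵢ)² = μ·ρ₀(eᵢ) for i = 1, 2; (iv) ρ₀(eᵢ)·ρ₀(σᵢ) = α⁻¹·ρ₀(eᵢ) for i = 1, 2; and (v) ρ₀(e₁)·ρ₀(σ₂)^{±1}·ρ₀(e₁) = α^{±1}·ρ₀(e₁) and ρ₀(e₂)·ρ₀(σ₁)^{±1}·ρ₀(e₂) = α^{±1}·ρ₀(e₂). -/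
/- STATEMENT 5: The matrices ρ₀(σ₁), ρ₀(σ₂), ρ₀(e₁), ρ₀(e₂) satisfy all the defining
relations of the 3-strand Birman–Murakami–Wenzl algebra C₃(α,β). -/

open Matrix

noncomputable def ρ₀σ₁ {F : Type*} [Field F] (α β : F) : Matrix (Fin 3) (Fin 3) F :=
  !![α⁻¹, 0, β + β⁻¹; 0, 0, -1; 0, 1, β + β⁻¹]

noncomputable def ρ₀σ₂ {F : Type*} [Field F] (α β : F) : Matrix (Fin 3) (Fin 3) F :=
  !![0, -1, 0; 1, β + β⁻¹, 0; 0, α⁻¹ * (β + β⁻¹), α⁻¹]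

noncomputable def ρ₀e₁ {F : Type*} [Field F] (α β : F) : Matrix (Fin 3) (Fin 3) F :=
  !![(α + α⁻¹) / (β + β⁻¹) - 1, α, 1; 0, 0, 0; 0, 0, 0]

noncomputable def ρ₀e₂ {F : Type*} [Field F] (α β : F) : Matrix (Fin 3) (Fin 3) F :=
  !![0, 0, 0; 0, 0, 0; 1, α⁻¹, (α + α⁻¹) / (β + β⁻¹) - 1]

theorem ρ₀σ₁_inv {F : Type*} [Field F] (α β : F) (hα : α ≠ 0) :
    (ρ₀σ₁ α β)⁻¹ = !![α, (β + β⁻¹) * α, 0; 0, β + β⁻¹, 1; 0, -1, 0] := by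
  apply Matrix.inv_eq_right_inv
  generalize hz : β + β⁻¹ = z
  ext i j
  fin_cases i <;> fin_cases j <;>
    simp [ρ₀σ₁, hz, Matrix.mul_apply, Fin.sum_univ_three] <;> field_simp
  ring

theorem ρ₀σ₂_inv {F : Type*} [Field F] (α β : F) (hα : α ≠ 0) :
    (ρ₀σ₂ α β)⁻¹ = !![β + β⁻¹, 1, 0; -1, 0, 0; β + β⁻¹, 0, α] := by
  apply Matrix.inv_eq_right_inv
  generalize hz : β + β⁻¹ = z
  ext i j
  fin_cases i <;> fin_cases j <;>
    simp [ρ₀σ₂, hz, Matrix.mul_apply, Fin.sum_univ_three] <;> field_simp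

theorem bmw_rho0_defining_relations {F : Type*} [Field F] (α β : F)
    (hα : α ≠ 0) (hβ : β ≠ 0) (hz : β + β⁻¹ ≠ 0) :
    -- (i) the braid relation
    ρ₀σ₁ α β * ρ₀σ₂ α β * ρ₀σ₁ α β = ρ₀σ₂ α β * ρ₀σ₁ α β * ρ₀σ₂ α β ∧
    -- (ii) the Kauffman skein relation
    ρ₀σ₁ α β + (ρ₀σ₁ α β)⁻¹ = (β + β⁻¹) • (1 + ρ₀e₁ α β) ∧
    ρ₀σ₂ α β + (ρ₀σ₂ α β)⁻¹ = (β + β⁻¹) • (1 + ρ₀e₂ α β) ∧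
    -- (iii) the idempotent relation
    ρ₀e₁ α β ^ 2 = ((α + α⁻¹) / (β + β⁻¹) - 1) • ρ₀e₁ α β ∧
    ρ₀e₂ α β ^ 2 = ((α + α⁻¹) / (β + β⁻¹) - 1) • ρ₀e₂ α β ∧
    -- (iv)
    ρ₀e₁ α β * ρ₀σ₁ α β = α⁻¹ • ρ₀e₁ α β ∧
    ρ₀e₂ α β * ρ₀σ₂ α β = α⁻¹ • ρ₀e₂ α β ∧
    -- (v)
    ρ₀e₁ α β * ρ₀σ₂ α β * ρ₀e₁ α β = α • ρ₀e₁ α β ∧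
    ρ₀e₁ α β * (ρ₀σ₂ α β)⁻¹ * ρ₀e₁ α β = α⁻¹ • ρ₀e₁ α β ∧
    ρ₀e₂ α β * ρ₀σ₁ α β * ρ₀e₂ α β = α • ρ₀e₂ α β ∧
    ρ₀e₂ α β * (ρ₀σ₁ α β)⁻¹ * ρ₀e₂ α β = α⁻¹ • ρ₀e₂ α β := by
  rw [ρ₀σ₁_inv α β hα, ρ₀σ₂_inv α β hα]
  unfold ρ₀σ₁ ρ₀σ₂ ρ₀e₁ ρ₀e₂
  generalize β + β⁻¹ = z at hz ⊢
  refine ⟨?_, ?_, ?_, ?_, ?_, ?_, ?_, ?_, ?_, ?_, ?_⟩ <;> ext i j <;>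
    fin_cases i <;> fin_cases j <;>
    simp [pow_two, Matrix.mul_apply, Fin.sum_univ_three,
      -mul_eq_mul_left_iff, -mul_eq_mul_right_iff] <;> field_simp <;> ring
end

section
/- The full twist on 3 strands F₃ := (σ₂σ₁)³ is represented by a scalar matrix in both BMW representations: for every natural number k, (ρ₀(σ₂)·ρ₀(σ₁))^{3k} = α^{−2k}·I₃ and (ρ₍₂₁₎(σ₂)·ρ₍₂₁₎(σ₁))^{3k} = (−1)^{k}·I₂, where I₃ and I₂ are the identity matrices of sizes 3 and 2. -/
/- STATEMENT 8: The full twist F₃ = (σ₂σ₁)³ is represented by a scalar matrix in both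
BMW representations: (ρ₀(σ₂)·ρ₀(σ₁))^{3k} = α^{−2k}·I₃ and
(ρ₍₂₁₎(σ₂)·ρ₍₂₁₎(σ₁))^{3k} = (−1)^k·I₂. -/

open Matrix

noncomputable def ρ21σ₁ {F : Type*} [Field F] (i β : F) : Matrix (Fin 2) (Fin 2) F :=
  !![β, i; 0, β⁻¹]

noncomputable def ρ21σ₂ {F : Type*} [Field F] (i β : F) : Matrix (Fin 2) (Fin 2) F :=
  !![β⁻¹, 0; i, β]

theorem ρ₀σ₂_mul_ρ₀σ₁_pow_three {F : Type*} [Field F] (α β : F) :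
    (ρ₀σ₂ α β * ρ₀σ₁ α β) ^ 3 = (α⁻¹ ^ 2) • (1 : Matrix (Fin 3) (Fin 3) F) := by
  have h : ρ₀σ₂ α β * ρ₀σ₁ α β = !![0, 0, 1; α⁻¹, 0, 0; 0, α⁻¹, 0] := by
    ext a b
    fin_cases a <;> fin_cases b <;> simp [ρ₀σ₁, ρ₀σ₂, Matrix.mul_apply, Fin.sum_univ_three]
  rw [h, pow_three]
  ext a b
  fin_cases a <;> fin_cases b <;> simp [Matrix.mul_apply, Fin.sum_univ_three, sq]

theorem ρ21σ₂_mul_ρ21σ₁_pow_three {F : Type*} [Field F] {i β : F}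
    (hi : i ^ 2 = -1) (hβ : β ≠ 0) :
    (ρ21σ₂ i β * ρ21σ₁ i β) ^ 3 = (-1 : F) • (1 : Matrix (Fin 2) (Fin 2) F) := by
  have h : ρ21σ₂ i β * ρ21σ₁ i β = !![1, β⁻¹ * i; i * β, 0] := by
    ext a b
    fin_cases a <;> fin_cases b <;>
      simp [ρ21σ₁, ρ21σ₂, Matrix.mul_apply, Fin.sum_univ_two, hβ, ← sq, hi]
  have hc : β⁻¹ * i * (i * β) = -1 := by
    field_simp
    exact hi
  rw [h, pow_three]
  ext a b
  fin_cases a <;> fin_cases b <;> simp [Matrix.mul_apply, Fin.sum_univ_two] <;> grind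

theorem full_twist_three_strands_scalar {F : Type*} [Field F] (i α β : F)
    (hi : i ^ 2 = -1) (hα : α ≠ 0) (hβ : β ≠ 0) (hz : β + β⁻¹ ≠ 0) (k : ℕ) :
    (ρ₀σ₂ α β * ρ₀σ₁ α β) ^ (3 * k) =
      (α ^ (-(2 * (k : ℤ)))) • (1 : Matrix (Fin 3) (Fin 3) F) ∧
    (ρ21σ₂ i β * ρ21σ₁ i β) ^ (3 * k) =
      ((-1 : F) ^ k) • (1 : Matrix (Fin 2) (Fin 2) F) := by
  constructor
  · rw [pow_mul, ρ₀σ₂_mul_ρ₀σ₁_pow_three, smul_pow, one_pow, ← pow_mul, inv_pow, _root_.zpow_neg]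
    norm_cast
  · rw [pow_mul, ρ21σ₂_mul_ρ21σ₁_pow_three hi hβ, smul_pow, one_pow]
end

section
/- For every integer k ≥ 1, the k-th power of the Jucys–Murphy twist E₃ := σ₁σ₂²σ₁ in the 3-dimensional BMW representation ρ₀ equals (ρ₀(σ₁)·ρ₀(σ₂)²·ρ₀(σ₁))^{k} = α^{−2k}·M, where M is the 3×3 matrix with entries M₁₁ = Σ_{i=0}^{2k} β^{2(k−i)}, M₁₂ = Σ_{i=0}^{2k−1} β^{2(k−i)−1}, M₁₃ = 0, M₂₁ = −Σ_{i=0}^{2k−1} β^{2(k−i)−1}, M₂₂ = −Σ_{i=0}^{2(k−1)} β^{2(k−i−1)}, M₂₃ = 0, M₃₁ = x, M₃₂ = y, M₃₃ = α^{2k}, with x := Σ_{i=0}^{2k−1} α^{i}·( β^{2k−i} + 2·Σ_{r=0}^{2k−2−i} β^{2(k−1−r)−i} + β^{−2k+i} ) and y := Σ_{i=0}^{2k−2} α^{i}·( β^{2k−1−i} + 2·Σ_{r=0}^{2k−3−i} β^{2k−3−i−2r} + β^{−2k+1+i} ); all sums with upper limit below the lower limit are 0. -/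
/- STATEMENT 10: For every integer k ≥ 1, the k-th power of the Jucys–Murphy twist
E₃ = σ₁σ₂²σ₁ in the 3-dimensional BMW representation ρ₀ equals α^{−2k}·M with the
explicitly given matrix M. -/

open Matrix Finset

/-- The balanced quantum integer `β ^ (n - 1) + β ^ (n - 3) + ⋯ + β ^ (1 - n)`. -/
def quantumInt {F : Type*} [Field F] (β : F) (n : ℕ) : F :=
  ∑ i ∈ Finset.range n, β ^ ((n : ℤ) - 1 - 2 * (i : ℤ))

/-- The convolution of the powers of `α` with the quantum integers, scaled by `β + β⁻¹`. -/
def quantumConv {F : Type*} [Field F] (α β : F) (n : ℕ) : F :=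
  ∑ i ∈ Finset.range n, α ^ i * ((β + β⁻¹) * quantumInt β (n - i))

section

variable {F : Type*} [Field F]

theorem quantumInt_zero (β : F) : quantumInt β 0 = 0 := by simp [quantumInt]

theorem quantumInt_one (β : F) : quantumInt β 1 = 1 := by simp [quantumInt]

theorem quantumInt_succ {β : F} (hβ : β ≠ 0) (n : ℕ) :
    quantumInt β (n + 1) = β * quantumInt β n + β ^ (-(n : ℤ)) := by
  simp only [quantumInt, sum_range_succ, mul_sum]
  congr 1
  · refine sum_congr rfl fun i _ => ?_
    rw [← zpow_one_add₀ hβ]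
    congr 1
    push_cast
    ring
  · congr 1
    push_cast
    ring

theorem quantumInt_add_two (β : F) (n : ℕ) :
    quantumInt β (n + 2) =
      β ^ ((n : ℤ) + 1) + quantumInt β n + β ^ (-((n : ℤ) + 1)) := by
  simp only [quantumInt]
  rw [sum_range_succ, sum_range_succ', add_comm (∑ i ∈ range n, _)]
  congr 1
  · congr 1
    · congr 1
      push_cast
      ring
    · refine sum_congr rfl fun i _ => ?_
      congr 1
      push_cast
      ring
  · congr 1
    push_cast
    ring

theorem quantumInt_add_two_add_self {β : F} (hβ : β ≠ 0) (n : ℕ) :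
    quantumInt β (n + 2) + quantumInt β n = (β + β⁻¹) * quantumInt β (n + 1) := by
  have h₁ := quantumInt_succ hβ (n + 1)
  have h₂ : β⁻¹ * quantumInt β (n + 1) = quantumInt β n + β ^ (-((n + 1 : ℕ) : ℤ)) := by
    rw [quantumInt_succ hβ n, mul_add, inv_mul_cancel_left₀ hβ, ← _root_.zpow_neg_one,
      ← zpow_add₀ hβ]
    congr 2
    push_cast
    ring
  rw [h₁, add_mul, h₂]
  ring

theorem quantumConv_succ (α β : F) (n : ℕ) :
    quantumConv α β (n + 1) =
      α * quantumConv α β n + (β + β⁻¹) * quantumInt β (n + 1) := by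
  simp only [quantumConv, sum_range_succ', mul_sum]
  simp only [pow_zero, one_mul, Nat.sub_zero, Nat.add_sub_add_right, pow_succ']
  simp only [mul_assoc]

theorem sum_zpow_eq_quantumInt (β : F) (n : ℕ) (f : ℕ → ℤ)
    (hf : ∀ i, f i = (n : ℤ) - 1 - 2 * (i : ℤ)) :
    ∑ i ∈ Finset.range n, β ^ f i = quantumInt β n := by
  simp only [quantumInt, hf]

theorem sum_eq_quantumConv {β : F} (hβ : β ≠ 0) (α : F) (n : ℕ) (a b : ℕ → ℤ)
    (l : ℕ → ℕ) (c : ℕ → ℕ → ℤ) (ha : ∀ i, a i = (n : ℤ) - i) (hb : ∀ i, b i = -((n : ℤ) - i))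
    (hl : ∀ i, l i = n - 1 - i) (hc : ∀ i r, c i r = (n : ℤ) - 2 - i - 2 * r) :
    ∑ i ∈ Finset.range n, α ^ i *
      (β ^ a i + 2 * ∑ r ∈ Finset.range (l i), β ^ c i r + β ^ b i) = quantumConv α β n := by
  refine sum_congr rfl fun i hi => ?_
  obtain ⟨m, rfl⟩ : ∃ m, n = i + m + 1 := ⟨n - i - 1, by grind⟩
  have hm : i + m + 1 - i = m + 1 := by omega
  have hlm : l i = m := by rw [hl]; omega
  have hai : a i = (m : ℤ) + 1 := by rw [ha]; push_cast; ring
  have hbi : b i = -((m : ℤ) + 1) := by rw [hb]; push_cast; ring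
  rw [hm, hlm, hai, hbi, sum_zpow_eq_quantumInt β m (c i) fun r => by rw [hc]; push_cast; ring,
    ← quantumInt_add_two_add_self hβ, quantumInt_add_two]
  ring

theorem jucysMurphy_eq {α β : F} (hα : α ≠ 0) (hβ : β ≠ 0) :
    ρ₀σ₁ α β * ρ₀σ₂ α β ^ 2 * ρ₀σ₁ α β =
      (α ^ 2)⁻¹ • !![(β + β⁻¹) ^ 2 - 1, β + β⁻¹, 0;
        -(β + β⁻¹), -1, 0;
        (β + β⁻¹) * (α + (β + β⁻¹)), β + β⁻¹, α ^ 2] := by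
  ext i j
  fin_cases i <;> fin_cases j <;>
    simp [ρ₀σ₁, ρ₀σ₂, pow_two, Matrix.mul_apply, Fin.sum_univ_three] <;> field_simp <;> ring

theorem jucysMurphy_pow_succ {α β : F} (hα : α ≠ 0) (hβ : β ≠ 0) (j : ℕ) :
    (ρ₀σ₁ α β * ρ₀σ₂ α β ^ 2 * ρ₀σ₁ α β) ^ (j + 1) =
      (α ^ (2 * (j + 1)))⁻¹ •
        !![quantumInt β (2 * j + 3), quantumInt β (2 * j + 2), 0;
          -quantumInt β (2 * j + 2), -quantumInt β (2 * j + 1), 0;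
          quantumConv α β (2 * j + 2), quantumConv α β (2 * j + 1), α ^ (2 * (j + 1))] := by
  have hU := quantumInt_add_two_add_self hβ
  have hX := quantumConv_succ α β
  have hX₀ : quantumConv α β 0 = 0 := by simp [quantumConv]
  rw [jucysMurphy_eq hα hβ]
  induction j with
  | zero =>
    have hU₂ := hU 0
    have hU₃ := hU 1
    have hX₁ := hX 0
    have hX₂ := hX 1
    norm_num [quantumInt_zero, quantumInt_one, hX₀] at hU₂ hU₃ hX₁ hX₂
    rw [pow_one]
    ext i j
    fin_cases i <;> fin_cases j <;>
      simp [quantumInt_one, hX₁, hX₂, hU₂] <;> grind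
  | succ j ih =>
    have h₁ := hU (2 * j + 1)
    have h₂ := hU (2 * j + 2)
    have h₃ := hU (2 * j + 3)
    have k₂ := hX (2 * j + 1)
    have k₃ := hX (2 * j + 2)
    have k₄ := hX (2 * j + 3)
    rw [pow_succ', ih, Matrix.smul_mul, Matrix.mul_smul, smul_smul,
      show (α ^ 2)⁻¹ * (α ^ (2 * (j + 1)))⁻¹ = (α ^ (2 * (j + 1 + 1)))⁻¹ by
        rw [← mul_inv, ← pow_add]; ring_nf]
    congr 1
    simp only [show 2 * (j + 1) = 2 * j + 2 by ring, show 2 * (j + 1 + 1) = 2 * j + 4 by ring,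
      add_assoc, Nat.reduceAdd] at *
    ext a b
    fin_cases a <;> fin_cases b <;>
      simp [Matrix.mul_apply, Fin.sum_univ_three] <;> grind

end

theorem jucys_murphy_rho0_power {F : Type*} [Field F] (α β : F)
    (hα : α ≠ 0) (hβ : β ≠ 0) (hz : β + β⁻¹ ≠ 0) (k : ℕ) (hk : 1 ≤ k) :
    (ρ₀σ₁ α β * ρ₀σ₂ α β ^ 2 * ρ₀σ₁ α β) ^ k =
      (α ^ (-(2 * (k : ℤ)))) •
        !![∑ i ∈ Finset.range (2 * k + 1), β ^ (2 * ((k : ℤ) - (i : ℤ))),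
             ∑ i ∈ Finset.range (2 * k), β ^ (2 * ((k : ℤ) - (i : ℤ)) - 1),
             0;
           -∑ i ∈ Finset.range (2 * k), β ^ (2 * ((k : ℤ) - (i : ℤ)) - 1),
             -∑ i ∈ Finset.range (2 * k - 1), β ^ (2 * ((k : ℤ) - (i : ℤ) - 1)),
             0;
           ∑ i ∈ Finset.range (2 * k), α ^ i *
               (β ^ (2 * (k : ℤ) - (i : ℤ)) +
                 2 * ∑ r ∈ Finset.range (2 * k - 1 - i),
                     β ^ (2 * ((k : ℤ) - 1 - (r : ℤ)) - (i : ℤ)) +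
                 β ^ (-(2 * (k : ℤ)) + (i : ℤ))),
             ∑ i ∈ Finset.range (2 * k - 1), α ^ i *
               (β ^ (2 * (k : ℤ) - 1 - (i : ℤ)) +
                 2 * ∑ r ∈ Finset.range (2 * k - 2 - i),
                     β ^ (2 * (k : ℤ) - 3 - (i : ℤ) - 2 * (r : ℤ)) +
                 β ^ (-(2 * (k : ℤ)) + 1 + (i : ℤ))),
             α ^ (2 * k)] := by
  obtain ⟨j, rfl⟩ : ∃ j, k = j + 1 := ⟨k - 1, by omega⟩
  rw [jucysMurphy_pow_succ hα hβ,
    sum_zpow_eq_quantumInt β (2 * (j + 1) + 1) _ fun i => by push_cast; ring,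
    sum_zpow_eq_quantumInt β (2 * (j + 1)) _ fun i => by push_cast; ring,
    show 2 * (j + 1) - 1 = 2 * j + 1 by omega,
    sum_zpow_eq_quantumInt β (2 * j + 1) _ fun i => by push_cast; ring,
    sum_eq_quantumConv hβ α (2 * (j + 1)) _ _ _ _ (fun i => by push_cast; ring)
      (fun i => by push_cast; ring) (fun i => by omega) (fun i r => by push_cast; ring),
    sum_eq_quantumConv hβ α (2 * j + 1) _ _ _ _ (fun i => by push_cast; ring)
      (fun i => by push_cast; ring) (fun i => by omega) (fun i r => by push_cast; ring),
    _root_.zpow_neg]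
  congr 2
  exact_mod_cast rfl
end

section
/- For every natural number n that is not divisible by 3, tr( (ρ₀(σ₁)·ρ₀(σ₂))ⁿ ) = 0; that is, the BMW character χ₀ vanishes on the 3-strand torus braids (σ₁σ₂)ⁿ for all torus knots T(3,n). -/
/- STATEMENT 11: For every natural number n not divisible by 3,
tr((ρ₀(σ₁)·ρ₀(σ₂))ⁿ) = 0: the BMW character χ₀ vanishes on the 3-strand torus braids
(σ₁σ₂)ⁿ for all torus knots T(3,n). -/

open Matrix

theorem ρ₀σ₁_mul_ρ₀σ₂ {F : Type*} [Field F] (α β : F) :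
    ρ₀σ₁ α β * ρ₀σ₂ α β =
      !![0, -α⁻¹ + α⁻¹ * (β + β⁻¹) ^ 2, α⁻¹ * (β + β⁻¹);
        0, -(α⁻¹ * (β + β⁻¹)), -α⁻¹;
        1, (β + β⁻¹) + α⁻¹ * (β + β⁻¹) ^ 2, α⁻¹ * (β + β⁻¹)] := by
  ext i j
  fin_cases i <;> fin_cases j <;>
    simp [ρ₀σ₁, ρ₀σ₂, Matrix.mul_apply, Fin.sum_univ_three] <;> ring

theorem trace_ρ₀σ₁_mul_ρ₀σ₂ {F : Type*} [Field F] (α β : F) :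
    (ρ₀σ₁ α β * ρ₀σ₂ α β).trace = 0 := by
  rw [ρ₀σ₁_mul_ρ₀σ₂, Matrix.trace_fin_three]
  simp

theorem trace_ρ₀σ₁_mul_ρ₀σ₂_sq {F : Type*} [Field F] (α β : F) :
    ((ρ₀σ₁ α β * ρ₀σ₂ α β) ^ 2).trace = 0 := by
  rw [ρ₀σ₁_mul_ρ₀σ₂]
  generalize α⁻¹ = a, β + β⁻¹ = z
  simp only [pow_two, Matrix.trace_fin_three, Matrix.mul_apply, Fin.sum_univ_three]
  simp
  ring

/-- The full twist `(σ₁σ₂)³` acts by a scalar. -/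
theorem ρ₀σ₁_mul_ρ₀σ₂_pow_three {F : Type*} [Field F] (α β : F) :
    (ρ₀σ₁ α β * ρ₀σ₂ α β) ^ 3 = (α⁻¹ ^ 2) • (1 : Matrix (Fin 3) (Fin 3) F) := by
  rw [ρ₀σ₁_mul_ρ₀σ₂]
  generalize α⁻¹ = a, β + β⁻¹ = z
  ext i j
  fin_cases i <;> fin_cases j <;>
    simp [pow_succ, Matrix.mul_apply, Fin.sum_univ_three] <;> ring

theorem chi0_vanishes_torus_3_strand {F : Type*} [Field F] (α β : F)
    (hα : α ≠ 0) (hβ : β ≠ 0) (hz : β + β⁻¹ ≠ 0) (n : ℕ) (hn : ¬ (3 ∣ n)) :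
    ((ρ₀σ₁ α β * ρ₀σ₂ α β) ^ n).trace = 0 := by
  have h : ((ρ₀σ₁ α β * ρ₀σ₂ α β) ^ (n % 3)).trace = 0 := by
    obtain h1 | h2 : n % 3 = 1 ∨ n % 3 = 2 := by omega
    · rw [h1, pow_one, trace_ρ₀σ₁_mul_ρ₀σ₂]
    · rw [h2, trace_ρ₀σ₁_mul_ρ₀σ₂_sq]
  rw [← Nat.div_add_mod n 3, pow_add, pow_mul, ρ₀σ₁_mul_ρ₀σ₂_pow_three, smul_pow, one_pow,
    smul_mul_assoc, one_mul, Matrix.trace_smul, h, smul_zero]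
end

section
/- For every odd natural number n, tr( (ρ₀(σ₁)·ρ₀(σ₂)·ρ₀(σ₁))ⁿ ) = −α^{−n}; that is, in the 4-strand BMW algebra, whose 3-dimensional representation ρ₀ sends σ₃ to ρ₀(σ₁), the character χ₀ takes the value −α^{−n} on the torus braids (σ₁σ₂σ₃)ⁿ for all torus knots T(4,n) with n odd. -/
/- STATEMENT 12: For every odd natural number n,
tr((ρ₀(σ₁)·ρ₀(σ₂)·ρ₀(σ₁))ⁿ) = −α^{−n}: in the 4-strand BMW algebra (whose representation
ρ₀ sends σ₃ to ρ₀(σ₁)), the character χ₀ takes the value −α^{−n} on the torus braids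
(σ₁σ₂σ₃)ⁿ for all torus knots T(4,n) with n odd. -/

open Matrix

theorem torus_braid_eq {F : Type*} [Field F] (α β : F) :
    ρ₀σ₁ α β * ρ₀σ₂ α β * ρ₀σ₁ α β =
      α⁻¹ • !![0, β + β⁻¹, 1; 0, -1, 0; 1, β + β⁻¹, 0] := by
  unfold ρ₀σ₁ ρ₀σ₂
  generalize β + β⁻¹ = z
  generalize α⁻¹ = a
  ext i j
  fin_cases i <;> fin_cases j <;> simp [Matrix.mul_apply, Fin.sum_univ_three] <;> ring

theorem torus_braid_sq {F : Type*} [Field F] (α β : F) :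
    (ρ₀σ₁ α β * ρ₀σ₂ α β * ρ₀σ₁ α β) ^ 2 = (α⁻¹ ^ 2) • (1 : Matrix (Fin 3) (Fin 3) F) := by
  rw [torus_braid_eq, smul_pow]
  congr 1
  ext i j
  fin_cases i <;> fin_cases j <;> simp [pow_two, Matrix.mul_apply, Fin.sum_univ_three]

theorem torus_braid_trace {F : Type*} [Field F] (α β : F) :
    (ρ₀σ₁ α β * ρ₀σ₂ α β * ρ₀σ₁ α β).trace = -α⁻¹ := by
  simp [torus_braid_eq, Matrix.trace_fin_three]

theorem chi0_torus_4_strand {F : Type*} [Field F] (α β : F)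
    (hα : α ≠ 0) (hβ : β ≠ 0) (hz : β + β⁻¹ ≠ 0) (n : ℕ) (hn : Odd n) :
    ((ρ₀σ₁ α β * ρ₀σ₂ α β * ρ₀σ₁ α β) ^ n).trace = -(α ^ (-(n : ℤ))) := by
  obtain ⟨k, rfl⟩ := hn
  rw [pow_succ, pow_mul, torus_braid_sq, smul_pow, one_pow, smul_mul_assoc, one_mul,
    Matrix.trace_smul, torus_braid_trace, _root_.zpow_neg, zpow_natCast, ← inv_pow, smul_eq_mul]
  ring
end

section
/- The 6×6 matrices ρ(σ₁), ρ(σ₂), ρ(σ₃) of the Birman–Wenzl representation ρ₍₁₁₎ of the 4-strand BMW algebra satisfy the braid relations: ρ(σ₁)·ρ(σ₂)·ρ(σ₁) = ρ(σ₂)·ρ(σ₁)·ρ(σ₂), ρ(σ₂)·ρ(σ₃)·ρ(σ₂) = ρ(σ₃)·ρ(σ₂)·ρ(σ₃), and ρ(σ₁)·ρ(σ₃) = ρ(σ₃)·ρ(σ₁). -/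
/- STATEMENT 13: The 6×6 matrices ρ(σ₁), ρ(σ₂), ρ(σ₃) of the Birman–Wenzl
representation ρ₍₁₁₎ of the 4-strand BMW algebra satisfy the braid relations. -/

open Matrix

noncomputable def ρσ₁ {F : Type*} [Field F] (α β : F) : Matrix (Fin 6) (Fin 6) F :=
  !![β⁻¹, 0, 0, 0, 0, 0;
     0, 0, 0, 0, -1, 0;
     0, 0, 0, 0, 0, -1;
     0, 0, 0, α⁻¹, α⁻¹ * (β + β⁻¹), α⁻¹ * β * (β + β⁻¹);
     0, 1, 0, 0, β + β⁻¹, 0;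
     0, 0, 1, 0, 0, β + β⁻¹]

noncomputable def ρσ₂ {F : Type*} [Field F] (α β : F) : Matrix (Fin 6) (Fin 6) F :=
  !![0, 0, -1, 0, 0, 0;
     0, α⁻¹, α⁻¹ * (β + β⁻¹), β + β⁻¹, 0, 0;
     1, 0, β + β⁻¹, 0, 0, 0;
     0, 0, 0, β + β⁻¹, 1, 0;
     0, 0, 0, -1, 0, 0;
     0, 0, 0, 0, 0, β⁻¹]

noncomputable def ρσ₃ {F : Type*} [Field F] (α β : F) : Matrix (Fin 6) (Fin 6) F :=
  !![α⁻¹, β + β⁻¹, 0, 0, β⁻¹ * (β + β⁻¹), 0;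
     0, β + β⁻¹, 1, 0, 0, 0;
     0, -1, 0, 0, 0, 0;
     0, 0, 0, β⁻¹, 0, 0;
     0, 0, 0, 0, β + β⁻¹, 1;
     0, 0, 0, 0, -1, 0]

set_option maxHeartbeats 1000000 in
theorem ρσ₁_ρσ₂_braid {F : Type*} [Field F] (α : F) {β : F} (hβ : β ≠ 0) :
    ρσ₁ α β * ρσ₂ α β * ρσ₁ α β = ρσ₂ α β * ρσ₁ α β * ρσ₂ α β := by
  ext i j
  fin_cases i <;> fin_cases j <;>
    simp [ρσ₁, ρσ₂, Matrix.mul_apply, Fin.sum_univ_six] <;> grind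

set_option maxHeartbeats 1000000 in
theorem ρσ₂_ρσ₃_braid {F : Type*} [Field F] (α : F) {β : F} (hβ : β ≠ 0) :
    ρσ₂ α β * ρσ₃ α β * ρσ₂ α β = ρσ₃ α β * ρσ₂ α β * ρσ₃ α β := by
  ext i j
  fin_cases i <;> fin_cases j <;>
    simp [ρσ₂, ρσ₃, Matrix.mul_apply, Fin.sum_univ_six] <;> grind

set_option maxHeartbeats 1000000 in
theorem ρσ₁_ρσ₃_comm {F : Type*} [Field F] (α : F) {β : F} (hβ : β ≠ 0) :
    ρσ₁ α β * ρσ₃ α β = ρσ₃ α β * ρσ₁ α β := by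
  ext i j
  fin_cases i <;> fin_cases j <;>
    simp [ρσ₁, ρσ₃, Matrix.mul_apply, Fin.sum_univ_six] <;> grind

theorem birman_wenzl_braid_relations {F : Type*} [Field F] (α β : F)
    (hα : α ≠ 0) (hβ : β ≠ 0) (hz : β + β⁻¹ ≠ 0) :
    ρσ₁ α β * ρσ₂ α β * ρσ₁ α β = ρσ₂ α β * ρσ₁ α β * ρσ₂ α β ∧
    ρσ₂ α β * ρσ₃ α β * ρσ₂ α β = ρσ₃ α β * ρσ₂ α β * ρσ₃ α β ∧
    ρσ₁ α β * ρσ₃ α β = ρσ₃ α β * ρσ₁ α β :=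
  ⟨ρσ₁_ρσ₂_braid α hβ, ρσ₂_ρσ₃_braid α hβ, ρσ₁_ρσ₃_comm α hβ⟩
end

section
/- The 6×6 matrices ρ(eᵢ) of the Birman–Wenzl representation ρ₍₁₁₎ satisfy: (i) the skein relation ρ(σᵢ) + ρ(σᵢ)⁻¹ = z·(1 + ρ(eᵢ)) for i = 1, 2, 3, where 1 is the 6×6 identity matrix; (ii) the idempotent relation ρ(eᵢ)² = μ·ρ(eᵢ) for i = 1, 2, 3; (iii) tr( ρ(eᵢ)ⁿ ) = μⁿ for all integers n ≥ 1 and i = 1, 2, 3; (iv) tr( ρ(e₁)·ρ(e₂) ) = 1 and tr( ρ(e₂)·ρ(e₃) ) = 1; and (v) tr( ρ(e₁)·ρ(σ₁) ) = α⁻¹·μ and tr( ρ(e₁)·ρ(σ₁)⁻¹ ) = α·μ. -/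
/- STATEMENT 15: The 6×6 matrices ρ(eᵢ) of the Birman–Wenzl representation ρ₍₁₁₎
satisfy the skein relation, the idempotent relation, tr(ρ(eᵢ)ⁿ) = μⁿ for n ≥ 1,
tr(ρ(e₁)ρ(e₂)) = tr(ρ(e₂)ρ(e₃)) = 1, tr(ρ(e₁)ρ(σ₁)) = α⁻¹μ and tr(ρ(e₁)ρ(σ₁)⁻¹) = αμ. -/

open Matrix

noncomputable def ρe₁ {F : Type*} [Field F] (α β : F) : Matrix (Fin 6) (Fin 6) F :=
  !![0, 0, 0, 0, 0, 0;
     0, 0, 0, 0, 0, 0;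
     0, 0, 0, 0, 0, 0;
     0, 1, β, (α + α⁻¹) / (β + β⁻¹) - 1, α⁻¹, α⁻¹ * β;
     0, 0, 0, 0, 0, 0;
     0, 0, 0, 0, 0, 0]

noncomputable def ρe₂ {F : Type*} [Field F] (α β : F) : Matrix (Fin 6) (Fin 6) F :=
  !![0, 0, 0, 0, 0, 0;
     1, (α + α⁻¹) / (β + β⁻¹) - 1, α⁻¹, 1, α, 0;
     0, 0, 0, 0, 0, 0;
     0, 0, 0, 0, 0, 0;
     0, 0, 0, 0, 0, 0;
     0, 0, 0, 0, 0, 0]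

noncomputable def ρe₃ {F : Type*} [Field F] (α β : F) : Matrix (Fin 6) (Fin 6) F :=
  !![(α + α⁻¹) / (β + β⁻¹) - 1, 1, α, 0, β⁻¹, α * β⁻¹;
     0, 0, 0, 0, 0, 0;
     0, 0, 0, 0, 0, 0;
     0, 0, 0, 0, 0, 0;
     0, 0, 0, 0, 0, 0;
     0, 0, 0, 0, 0, 0]

theorem Matrix.add_inv_eq_of_mul_sub_eq_one {n R : Type*} [Fintype n] [DecidableEq n]
    [CommRing R] {A B : Matrix n n R} (h : A * (B - A) = 1) : A + A⁻¹ = B := by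
  rw [Matrix.inv_eq_right_inv h, add_sub_cancel]

theorem Matrix.trace_pow_of_sq_eq_smul {n R : Type*} [Fintype n] [DecidableEq n]
    [CommRing R] {A : Matrix n n R} {c : R} (hA : A ^ 2 = c • A) (ht : A.trace = c)
    {k : ℕ} (hk : 1 ≤ k) : (A ^ k).trace = c ^ k := by
  have hpow : ∀ m : ℕ, A ^ (m + 1) = c ^ m • A := by
    intro m
    induction m with
    | zero => simp
    | succ m ih => rw [pow_succ, ih, smul_mul_assoc, ← sq, hA, smul_smul, ← pow_succ]
  obtain ⟨m, rfl⟩ := Nat.exists_eq_add_of_le' hk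
  rw [hpow, Matrix.trace_smul, ht, smul_eq_mul, ← pow_succ]

theorem mul_one_add_div_sub_one {F : Type*} [Field F] (a : F) {z : F} (hz : z ≠ 0) :
    z * (1 + (a / z - 1)) = a := by
  rw [add_sub_cancel, mul_div_cancel₀ _ hz]

theorem ρσ₁_add_inv {F : Type*} [Field F] {α β : F}
    (hα : α ≠ 0) (hβ : β ≠ 0) (hz : β + β⁻¹ ≠ 0) :
    ρσ₁ α β + (ρσ₁ α β)⁻¹ = (β + β⁻¹) • (1 + ρe₁ α β) := by
  apply Matrix.add_inv_eq_of_mul_sub_eq_one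
  have hμ := mul_one_add_div_sub_one (α + α⁻¹) hz
  ext i j
  fin_cases i <;> fin_cases j <;>
    simp [ρσ₁, ρe₁, Matrix.mul_apply, Fin.sum_univ_succ, Matrix.one_apply, hα, hβ] <;>
    grind

theorem ρσ₂_add_inv {F : Type*} [Field F] {α β : F}
    (hα : α ≠ 0) (hβ : β ≠ 0) (hz : β + β⁻¹ ≠ 0) :
    ρσ₂ α β + (ρσ₂ α β)⁻¹ = (β + β⁻¹) • (1 + ρe₂ α β) := by
  apply Matrix.add_inv_eq_of_mul_sub_eq_one
  have hμ := mul_one_add_div_sub_one (α + α⁻¹) hz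
  ext i j
  fin_cases i <;> fin_cases j <;>
    simp [ρσ₂, ρe₂, Matrix.mul_apply, Fin.sum_univ_succ, Matrix.one_apply, hα, hβ] <;>
    grind

theorem ρσ₃_add_inv {F : Type*} [Field F] {α β : F}
    (hα : α ≠ 0) (hβ : β ≠ 0) (hz : β + β⁻¹ ≠ 0) :
    ρσ₃ α β + (ρσ₃ α β)⁻¹ = (β + β⁻¹) • (1 + ρe₃ α β) := by
  apply Matrix.add_inv_eq_of_mul_sub_eq_one
  have hμ := mul_one_add_div_sub_one (α + α⁻¹) hz
  ext i j
  fin_cases i <;> fin_cases j <;>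
    simp [ρσ₃, ρe₃, Matrix.mul_apply, Fin.sum_univ_succ, Matrix.one_apply, hα, hβ] <;>
    grind

theorem ρe₁_sq {F : Type*} [Field F] (α β : F) :
    ρe₁ α β ^ 2 = ((α + α⁻¹) / (β + β⁻¹) - 1) • ρe₁ α β := by
  ext i j
  fin_cases i <;> fin_cases j <;> simp [sq, ρe₁, Matrix.mul_apply, Fin.sum_univ_succ]

theorem trace_ρe₁ {F : Type*} [Field F] (α β : F) :
    (ρe₁ α β).trace = (α + α⁻¹) / (β + β⁻¹) - 1 := by
  simp [ρe₁, Matrix.trace, Fin.sum_univ_succ]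

theorem ρe₂_sq {F : Type*} [Field F] (α β : F) :
    ρe₂ α β ^ 2 = ((α + α⁻¹) / (β + β⁻¹) - 1) • ρe₂ α β := by
  ext i j
  fin_cases i <;> fin_cases j <;> simp [sq, ρe₂, Matrix.mul_apply, Fin.sum_univ_succ]

theorem trace_ρe₂ {F : Type*} [Field F] (α β : F) :
    (ρe₂ α β).trace = (α + α⁻¹) / (β + β⁻¹) - 1 := by
  simp [ρe₂, Matrix.trace, Fin.sum_univ_succ]

theorem ρe₃_sq {F : Type*} [Field F] (α β : F) :
    ρe₃ α β ^ 2 = ((α + α⁻¹) / (β + β⁻¹) - 1) • ρe₃ α β := by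
  ext i j
  fin_cases i <;> fin_cases j <;> simp [sq, ρe₃, Matrix.mul_apply, Fin.sum_univ_succ]

theorem trace_ρe₃ {F : Type*} [Field F] (α β : F) :
    (ρe₃ α β).trace = (α + α⁻¹) / (β + β⁻¹) - 1 := by
  simp [ρe₃, Matrix.trace, Fin.sum_univ_succ]

theorem trace_ρe₁_mul_ρσ₁ {F : Type*} [Field F] (α β : F) :
    (ρe₁ α β * ρσ₁ α β).trace = α⁻¹ * ((α + α⁻¹) / (β + β⁻¹) - 1) := by
  simp [ρe₁, ρσ₁, Matrix.trace, Fin.sum_univ_succ, mul_comm]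

theorem birman_wenzl_e_relations {F : Type*} [Field F] (α β : F)
    (hα : α ≠ 0) (hβ : β ≠ 0) (hz : β + β⁻¹ ≠ 0) :
    -- (i) the skein relation
    (ρσ₁ α β + (ρσ₁ α β)⁻¹ = (β + β⁻¹) • (1 + ρe₁ α β) ∧
     ρσ₂ α β + (ρσ₂ α β)⁻¹ = (β + β⁻¹) • (1 + ρe₂ α β) ∧
     ρσ₃ α β + (ρσ₃ α β)⁻¹ = (β + β⁻¹) • (1 + ρe₃ α β)) ∧
    -- (ii) the idempotent relation
    (ρe₁ α β ^ 2 = ((α + α⁻¹) / (β + β⁻¹) - 1) • ρe₁ α β ∧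
     ρe₂ α β ^ 2 = ((α + α⁻¹) / (β + β⁻¹) - 1) • ρe₂ α β ∧
     ρe₃ α β ^ 2 = ((α + α⁻¹) / (β + β⁻¹) - 1) • ρe₃ α β) ∧
    -- (iii) trace of powers
    ((∀ n : ℕ, 1 ≤ n → (ρe₁ α β ^ n).trace = ((α + α⁻¹) / (β + β⁻¹) - 1) ^ n) ∧
     (∀ n : ℕ, 1 ≤ n → (ρe₂ α β ^ n).trace = ((α + α⁻¹) / (β + β⁻¹) - 1) ^ n) ∧
     (∀ n : ℕ, 1 ≤ n → (ρe₃ α β ^ n).trace = ((α + α⁻¹) / (β + β⁻¹) - 1) ^ n)) ∧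
    -- (iv)
    ((ρe₁ α β * ρe₂ α β).trace = 1 ∧ (ρe₂ α β * ρe₃ α β).trace = 1) ∧
    -- (v)
    ((ρe₁ α β * ρσ₁ α β).trace = α⁻¹ * ((α + α⁻¹) / (β + β⁻¹) - 1) ∧
     (ρe₁ α β * (ρσ₁ α β)⁻¹).trace = α * ((α + α⁻¹) / (β + β⁻¹) - 1)) := by
  refine ⟨⟨ρσ₁_add_inv hα hβ hz, ρσ₂_add_inv hα hβ hz, ρσ₃_add_inv hα hβ hz⟩,
    ⟨ρe₁_sq α β, ρe₂_sq α β, ρe₃_sq α β⟩,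
    ⟨fun _ => Matrix.trace_pow_of_sq_eq_smul (ρe₁_sq α β) (trace_ρe₁ α β),
      fun _ => Matrix.trace_pow_of_sq_eq_smul (ρe₂_sq α β) (trace_ρe₂ α β),
      fun _ => Matrix.trace_pow_of_sq_eq_smul (ρe₃_sq α β) (trace_ρe₃ α β)⟩,
    ⟨?_, ?_⟩, ?_, ?_⟩
  · simp [ρe₁, ρe₂, Matrix.trace, Fin.sum_univ_succ]
  · simp [ρe₂, ρe₃, Matrix.trace, Fin.sum_univ_succ]
  · exact trace_ρe₁_mul_ρσ₁ α β
  · rw [eq_sub_of_add_eq' (ρσ₁_add_inv hα hβ hz), mul_sub, Matrix.trace_sub,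
      trace_ρe₁_mul_ρσ₁, mul_smul_comm, mul_add, mul_one, ← sq, ρe₁_sq, Matrix.trace_smul,
      Matrix.trace_add, Matrix.trace_smul, trace_ρe₁, smul_eq_mul, smul_eq_mul]
    linear_combination
      ((α + α⁻¹) / (β + β⁻¹) - 1) * mul_one_add_div_sub_one (α + α⁻¹) hz
end

section
/- For all natural numbers j, k, l, the character χ₍₂₁₎ of the 3-strand knot family K⁻_{j,k,l} (the closure of the braid σ₁σ₂^{−(1+2j)} ⊗ F₃^{l} ⊗ E₃^{k}, with F₃ = (σ₂σ₁)³ the full twist and E₃ = σ₁σ₂²σ₁ the Jucys–Murphy twist) is given by tr( ρ₍₂₁₎(σ₁) · ρ₍₂₁₎(σ₂)^{−(1+2j)} · (ρ₍₂₁₎(σ₂)·ρ₍₂₁₎(σ₁))^{3l} · (ρ₍₂₁₎(σ₁)·ρ₍₂₁₎(σ₂)²·ρ₍₂₁₎(σ₁))^{k} ) = (−1)^{k+l} · ( β^{2(j+k+1)} + Σ_{i=0}^{2j} β^{2(j+k−i)} + Σ_{i=0}^{2k−1} β^{2(k−j−i−1)} + β^{−2(j+k+1)} ), where a sum whose upper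 limit is below its lower limit is 0. -/
/- STATEMENT 17: For all natural numbers j, k, l, the character χ₍₂₁₎ of the 3-strand
knot family K⁻_{j,k,l} (closure of σ₁σ₂^{−(1+2j)} ⊗ F₃^l ⊗ E₃^k) is given by
tr(ρ₍₂₁₎(σ₁)·ρ₍₂₁₎(σ₂)^{−(1+2j)}·(ρ₍₂₁₎(σ₂)ρ₍₂₁₎(σ₁))^{3l}·(ρ₍₂₁₎(σ₁)ρ₍₂₁₎(σ₂)²ρ₍₂₁₎(σ₁))^k)
  = (−1)^{k+l}·(β^{2(j+k+1)} + Σ_{i=0}^{2j} β^{2(j+k−i)} + Σ_{i=0}^{2k−1} β^{2(k−j−i−1)}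
                 + β^{−2(j+k+1)}). -/

open Matrix Finset

theorem ρ21σ₂_inv {F : Type*} [Field F] (i β : F) (hβ : β ≠ 0) :
    (ρ21σ₂ i β)⁻¹ = !![β, 0; -i, β⁻¹] := by
  apply Matrix.inv_eq_right_inv
  ext a b
  fin_cases a <;> fin_cases b <;> simp [ρ21σ₂, Matrix.mul_apply, Fin.sum_univ_two, hβ, mul_comm]

theorem ρ21σ₂_inv_pow {F : Type*} [Field F] (i β : F) (hβ : β ≠ 0) (n : ℕ) :
    (ρ21σ₂ i β)⁻¹ ^ n =
      !![β ^ (n : ℤ), 0;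
        -i * ∑ m ∈ Finset.range n, β ^ ((n : ℤ) - 1 - 2 * (m : ℤ)), β ^ (-(n : ℤ))] := by
  induction n with
  | zero => simp [Matrix.one_fin_two]
  | succ n ih =>
    have hsum : ∑ m ∈ Finset.range (n + 1), β ^ (((n + 1 : ℕ) : ℤ) - 1 - 2 * (m : ℤ)) =
        (∑ m ∈ Finset.range n, β ^ ((n : ℤ) - 1 - 2 * (m : ℤ))) * β + β ^ (-(n : ℤ)) := by
      rw [Finset.sum_range_succ, Finset.sum_mul]
      congr 1
      · refine Finset.sum_congr rfl fun m _ => ?_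
        rw [← zpow_add_one₀ hβ]
        congr 1
        push_cast
        ring
      · congr 1
        push_cast
        ring
    have hpos : β ^ ((n + 1 : ℕ) : ℤ) = β ^ (n : ℤ) * β := by
      rw [← zpow_add_one₀ hβ, Nat.cast_succ]
    have hneg : β ^ (-((n + 1 : ℕ) : ℤ)) = β ^ (-(n : ℤ)) * β⁻¹ := by
      rw [← zpow_sub_one₀ hβ]
      congr 1
      push_cast
      ring
    rw [pow_succ, ih, ρ21σ₂_inv i β hβ, hsum, hpos, hneg, Matrix.mul_fin_two]
    congr! 3
    all_goals ring_nf

theorem ρ21_fullTwist {F : Type*} [Field F] (i β : F) (hi : i ^ 2 = -1) (hβ : β ≠ 0) :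
    (ρ21σ₂ i β * ρ21σ₁ i β) ^ 3 = -1 := by
  have h : ρ21σ₂ i β * ρ21σ₁ i β = !![1, i * β⁻¹; i * β, 0] := by
    rw [ρ21σ₂, ρ21σ₁, Matrix.mul_fin_two]
    ext a b
    fin_cases a <;> fin_cases b <;> simp [hβ, ← sq, hi, mul_comm]
  rw [h, pow_succ, sq, Matrix.mul_fin_two, Matrix.mul_fin_two, Matrix.one_fin_two]
  ext a b
  fin_cases a <;> fin_cases b <;> simp <;> field_simp <;> grind

theorem ρ21_jucysMurphy {F : Type*} [Field F] (i β : F) (hi : i ^ 2 = -1) (hβ : β ≠ 0) :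
    ρ21σ₁ i β * ρ21σ₂ i β ^ 2 * ρ21σ₁ i β = -(ρ21σ₂ i β)⁻¹ ^ 2 := by
  rw [ρ21σ₂_inv i β hβ, ρ21σ₂, ρ21σ₁]
  simp only [sq, Matrix.mul_fin_two]
  ext a b
  fin_cases a <;> fin_cases b <;> simp <;> field_simp <;> grind

theorem chi21_Kminus_family {F : Type*} [Field F] (i β : F)
    (hi : i ^ 2 = -1) (hβ : β ≠ 0) (j k l : ℕ) :
    (ρ21σ₁ i β * ((ρ21σ₂ i β)⁻¹) ^ (1 + 2 * j) *
        (ρ21σ₂ i β * ρ21σ₁ i β) ^ (3 * l) *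
        (ρ21σ₁ i β * ρ21σ₂ i β ^ 2 * ρ21σ₁ i β) ^ k).trace =
      (-1 : F) ^ (k + l) *
        (β ^ (2 * ((j : ℤ) + (k : ℤ) + 1)) +
          ∑ m ∈ Finset.range (2 * j + 1), β ^ (2 * ((j : ℤ) + (k : ℤ) - (m : ℤ))) +
          ∑ m ∈ Finset.range (2 * k), β ^ (2 * ((k : ℤ) - (j : ℤ) - (m : ℤ) - 1)) +
          β ^ (-(2 * ((j : ℤ) + (k : ℤ) + 1)))) := by
  have hpow : (ρ21σ₂ i β)⁻¹ ^ (1 + 2 * j) * (ρ21σ₂ i β)⁻¹ ^ (2 * k) =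
      (ρ21σ₂ i β)⁻¹ ^ ((2 * j + 1) + 2 * k) := by
    rw [← pow_add, add_comm 1]
  have hprod : ρ21σ₁ i β * ((ρ21σ₂ i β)⁻¹) ^ (1 + 2 * j) *
        (ρ21σ₂ i β * ρ21σ₁ i β) ^ (3 * l) *
        (ρ21σ₁ i β * ρ21σ₂ i β ^ 2 * ρ21σ₁ i β) ^ k =
      (-1 : F) ^ (k + l) • (ρ21σ₁ i β * (ρ21σ₂ i β)⁻¹ ^ ((2 * j + 1) + 2 * k)) := by
    rw [pow_mul _ 3, ρ21_fullTwist i β hi hβ, ρ21_jucysMurphy i β hi hβ,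
      neg_pow _ k, ← pow_mul, ← hpow, pow_add (-1 : F)]
    rcases Nat.even_or_odd k with hk | hk <;> rcases Nat.even_or_odd l with hl | hl <;>
      simp [hk.neg_one_pow, hl.neg_one_pow, mul_assoc]
  rw [hprod, Matrix.trace_smul, smul_eq_mul, ρ21σ₂_inv_pow i β hβ, ρ21σ₁, Matrix.mul_fin_two,
    Matrix.trace_fin_two_of, Finset.sum_range_add]
  congr 1
  have hpos : β * β ^ ((2 * j + 1 + 2 * k : ℕ) : ℤ) = β ^ (2 * ((j : ℤ) + (k : ℤ) + 1)) := by
    rw [← zpow_one_add₀ hβ]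
    congr 1
    push_cast
    ring
  have hneg : β⁻¹ * β ^ (-((2 * j + 1 + 2 * k : ℕ) : ℤ)) =
      β ^ (-(2 * ((j : ℤ) + (k : ℤ) + 1))) := by
    rw [← _root_.zpow_neg_one, ← zpow_add₀ hβ]
    congr 1
    push_cast
    ring
  have hfst (m : ℕ) : ((2 * j + 1 + 2 * k : ℕ) : ℤ) - 1 - 2 * (m : ℤ) =
      2 * ((j : ℤ) + (k : ℤ) - (m : ℤ)) := by
    push_cast
    ring
  have hsnd (m : ℕ) : 2 * ((j : ℤ) + (k : ℤ) - ((2 * j + 1 + m : ℕ) : ℤ)) =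
      2 * ((k : ℤ) - (j : ℤ) - (m : ℤ) - 1) := by
    push_cast
    ring
  simp only [hfst, hsnd]
  rw [hpos, hneg]
  linear_combination (-(∑ m ∈ Finset.range (2 * j + 1), β ^ (2 * ((j : ℤ) + (k : ℤ) - (m : ℤ)))) -
    ∑ m ∈ Finset.range (2 * k), β ^ (2 * ((k : ℤ) - (j : ℤ) - (m : ℤ) - 1))) * hi
end
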